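/- Let $\mathcal{R}$ be an algebraic Kähler curvature tensor on $\mathbb{C}^n$, $n \geq 2$, and suppose there exists a real $n \times n$ matrix $(a_{ij})$ with $\sum_{i\neq j} a_{ij} + 2\sum_i a_{ii} > 0$ such that for every unitary frame $\{f_1,\dots,f_n\}$, $\sum_{i,j=1}^n \mathcal{R}(f_i,\bar f_i,f_j,\bar f_j)\,a_{ij} \geq 0$. Then the scalar curvature $S = \sum_{i,j} \mathcal{R}(e_i,\bar e_i,e_j,\bar e_j)$ is nonnegative. Moreover, if strict inequality holds for at least one unitary frame, then $S > 0$. -/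

import Mathlib

open Finset

noncomputable section

/-- An algebraic Kähler curvature tensor on `ℂⁿ`: complex linear in the first and
third (unbarred) slots, conjugate linear in the second and fourth (barred) slots,
with the pair symmetry `R(X,Ȳ,Z,W̄) = R(Z,W̄,X,Ȳ)`, the Kähler symmetry
`R(X,Ȳ,Z,W̄) = R(Z,Ȳ,X,W̄)`, and the reality condition
`conj R(X,Ȳ,Z,W̄) = R(Y,X̄,W,Z̄)`. -/
structure AKCT (n : ℕ) where
  R : (Fin n → ℂ) → (Fin n → ℂ) → (Fin n → ℂ) → (Fin n → ℂ) → ℂ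
  smul_fst : ∀ (a : ℂ) (X Y Z W), R (a • X) Y Z W = a * R X Y Z W
  add_fst : ∀ (X X' Y Z W), R (X + X') Y Z W = R X Y Z W + R X' Y Z W
  smul_snd : ∀ (a : ℂ) (X Y Z W), R X (a • Y) Z W = (starRingEnd ℂ) a * R X Y Z W
  add_snd : ∀ (X Y Y' Z W), R X (Y + Y') Z W = R X Y Z W + R X Y' Z W
  pair_symm : ∀ (X Y Z W), R X Y Z W = R Z W X Y
  kahler_symm : ∀ (X Y Z W), R X Y Z W = R Z Y X W
  conj_symm : ∀ (X Y Z W), (starRingEnd ℂ) (R X Y Z W) = R Y X W Z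

/-- The standard Hermitian inner product on `ℂⁿ` (conjugate linear in the first slot). -/
def hermInner {n : ℕ} (v w : Fin n → ℂ) : ℂ := ∑ k, (starRingEnd ℂ) (v k) * w k

/-- A unitary frame of `ℂⁿ`. -/
def UnitaryFrame {n : ℕ} (e : Fin n → Fin n → ℂ) : Prop :=
  ∀ i j, hermInner (e i) (e j) = if i = j then 1 else 0

/-- An orthonormal (unitary) pair of vectors in `ℂⁿ`. -/
def OrthPair {n : ℕ} (V W : Fin n → ℂ) : Prop :=
  hermInner V V = 1 ∧ hermInner W W = 1 ∧ hermInner V W = 0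

/-- Nonnegative quadratic orthogonal bisectional curvature. -/
def NQOBC {n : ℕ} (𝓡 : AKCT n) : Prop :=
  ∀ e : Fin n → Fin n → ℂ, UnitaryFrame e →
    ∀ ξ : Fin n → ℝ,
      0 ≤ ∑ i, ∑ j, (𝓡.R (e i) (e i) (e j) (e j)).re * (ξ i - ξ j) ^ 2

/-- The `k`-th standard basis vector of `ℂⁿ`. -/
def stdVec {n : ℕ} (k : Fin n) : Fin n → ℂ := fun m => if m = k then 1 else 0

/-- The scalar curvature of an algebraic Kähler curvature tensor
(computed in the standard basis). -/
def scalarCurv {n : ℕ} (𝓡 : AKCT n) : ℝ :=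
  ∑ i, ∑ j, (𝓡.R (stdVec i) (stdVec i) (stdVec j) (stdVec j)).re

end

noncomputable section

namespace AKCT

variable {n : ℕ} (𝓡 : AKCT n)

lemma map_sum_fst {ι : Type*} (s : Finset ι) (x : ι → ℂ) (v : ι → Fin n → ℂ)
    (Y Z W : Fin n → ℂ) :
    𝓡.R (∑ a ∈ s, x a • v a) Y Z W = ∑ a ∈ s, x a * 𝓡.R (v a) Y Z W := by
  classical
  induction s using Finset.induction_on with
  | empty => simpa using 𝓡.smul_fst 0 0 Y Z W
  | insert a s ha ih => rw [sum_insert ha, sum_insert ha, 𝓡.add_fst, 𝓡.smul_fst, ih]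

lemma map_sum_snd {ι : Type*} (s : Finset ι) (x : ι → ℂ) (v : ι → Fin n → ℂ)
    (X Z W : Fin n → ℂ) :
    𝓡.R X (∑ a ∈ s, x a • v a) Z W = ∑ a ∈ s, starRingEnd ℂ (x a) * 𝓡.R X (v a) Z W := by
  classical
  induction s using Finset.induction_on with
  | empty => simpa using 𝓡.smul_snd 0 X 0 Z W
  | insert a s ha ih => rw [sum_insert ha, sum_insert ha, 𝓡.add_snd, 𝓡.smul_snd, ih]

lemma map_sum_thd {ι : Type*} (s : Finset ι) (x : ι → ℂ) (v : ι → Fin n → ℂ)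
    (X Y W : Fin n → ℂ) :
    𝓡.R X Y (∑ a ∈ s, x a • v a) W = ∑ a ∈ s, x a * 𝓡.R X Y (v a) W := by
  simp_rw [𝓡.pair_symm X Y, map_sum_fst]

lemma map_sum_fth {ι : Type*} (s : Finset ι) (x : ι → ℂ) (v : ι → Fin n → ℂ)
    (X Y Z : Fin n → ℂ) :
    𝓡.R X Y Z (∑ a ∈ s, x a • v a) = ∑ a ∈ s, starRingEnd ℂ (x a) * 𝓡.R X Y Z (v a) := by
  simp_rw [𝓡.pair_symm X Y, map_sum_snd]

lemma map_sum {ι : Type*} [Fintype ι] (x y z w : ι → ℂ) (v : ι → Fin n → ℂ) :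
    𝓡.R (∑ a, x a • v a) (∑ b, y b • v b) (∑ c, z c • v c) (∑ d, w d • v d) =
      ∑ a, ∑ b, ∑ c, ∑ d, (x a * starRingEnd ℂ (y b) * z c * starRingEnd ℂ (w d)) *
        𝓡.R (v a) (v b) (v c) (v d) := by
  simp_rw [map_sum_fst, map_sum_snd, map_sum_thd, map_sum_fth, mul_sum]
  refine sum_congr rfl fun a _ => sum_congr rfl fun b _ => sum_congr rfl fun c _ =>
    sum_congr rfl fun d _ => by ring

/-- The sum of the bisectional curvatures over all pairs of vectors of a frame. -/
def frameScalar (f : Fin n → Fin n → ℂ) : ℂ := ∑ i, ∑ j, 𝓡.R (f i) (f i) (f j) (f j)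

/-- The sum of the holomorphic sectional curvatures over the vectors of a frame. -/
def frameHol (f : Fin n → Fin n → ℂ) : ℂ := ∑ i, 𝓡.R (f i) (f i) (f i) (f i)

end AKCT

lemma unitaryFrame_iff {n : ℕ} (e : Fin n → Fin n → ℂ) :
    UnitaryFrame e ↔ Matrix.of e ∈ Matrix.unitaryGroup (Fin n) ℂ := by
  rw [Matrix.mem_unitaryGroup_iff, ← Matrix.ext_iff]
  have key : ∀ i j, (Matrix.of e * star (Matrix.of e)) j i = hermInner (e i) (e j) := by
    intro i j
    simp [Matrix.mul_apply, Matrix.star_apply, hermInner, mul_comm]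
  constructor
  · intro h i j
    rw [key, h, Matrix.one_apply]
    simp only [eq_comm]
  · intro h i j
    rw [← key, h, Matrix.one_apply]
    simp only [eq_comm]

lemma UnitaryFrame.comb {n : ℕ} {u f : Fin n → Fin n → ℂ} (hu : UnitaryFrame u)
    (hf : UnitaryFrame f) : UnitaryFrame fun k => ∑ j, u k j • f j := by
  rw [unitaryFrame_iff] at *
  convert mul_mem hu hf using 1
  ext k m
  simp [Matrix.mul_apply]

lemma UnitaryFrame.comp_perm {n : ℕ} {f : Fin n → Fin n → ℂ} (hf : UnitaryFrame f)
    (σ : Equiv.Perm (Fin n)) : UnitaryFrame fun i => f (σ i) := fun i j => by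
  simp [hf (σ i) (σ j)]

lemma unitaryFrame_stdVec {n : ℕ} : UnitaryFrame (stdVec : Fin n → Fin n → ℂ) := fun i j => by
  simp [hermInner, stdVec, eq_comm]

lemma UnitaryFrame.sum_mul_conj {n : ℕ} {f : Fin n → Fin n → ℂ} (hf : UnitaryFrame f)
    (a b : Fin n) : ∑ i, f i a * starRingEnd ℂ (f i b) = if a = b then 1 else 0 := by
  rw [unitaryFrame_iff, Matrix.mem_unitaryGroup_iff'] at hf
  have := congrFun (congrFun hf b) a
  simpa [Matrix.mul_apply, Matrix.star_apply, Matrix.one_apply, mul_comm, eq_comm] using this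

lemma sum_smul_stdVec {n : ℕ} (v : Fin n → ℂ) : ∑ k, v k • stdVec k = v := by
  ext m
  simp [stdVec]

namespace AKCT

variable {n : ℕ} (𝓡 : AKCT n)

lemma sum_frame_eq_sum_stdVec {f : Fin n → Fin n → ℂ} (hf : UnitaryFrame f)
    (Z W : Fin n → ℂ) : ∑ i, 𝓡.R (f i) (f i) Z W = ∑ k, 𝓡.R (stdVec k) (stdVec k) Z W := by
  have hexp : ∀ i, 𝓡.R (f i) (f i) Z W = ∑ a, ∑ b,
      f i a * starRingEnd ℂ (f i b) * 𝓡.R (stdVec a) (stdVec b) Z W := by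
    intro i
    conv_lhs => rw [← sum_smul_stdVec (f i), map_sum_fst]
    simp only [map_sum_snd, mul_sum, mul_assoc]
  calc ∑ i, 𝓡.R (f i) (f i) Z W
      = ∑ a, ∑ b, (∑ i, f i a * starRingEnd ℂ (f i b)) * 𝓡.R (stdVec a) (stdVec b) Z W := by
        simp only [hexp, sum_mul]
        rw [sum_comm]
        exact sum_congr rfl fun a _ => sum_comm
    _ = _ := by simp [hf.sum_mul_conj]

lemma frameScalar_eq_stdVec {f : Fin n → Fin n → ℂ} (hf : UnitaryFrame f) :
    𝓡.frameScalar f = 𝓡.frameScalar stdVec := by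
  rw [frameScalar, sum_comm]
  simp_rw [𝓡.sum_frame_eq_sum_stdVec hf]
  rw [frameScalar, sum_comm]
  refine sum_congr rfl fun k _ => ?_
  rw [sum_congr rfl fun j _ => 𝓡.pair_symm (stdVec k) (stdVec k) (f j) (f j),
    𝓡.sum_frame_eq_sum_stdVec hf]
  exact sum_congr rfl fun j _ => 𝓡.pair_symm _ _ _ _

lemma frameScalar_re {f : Fin n → Fin n → ℂ} (hf : UnitaryFrame f) :
    (𝓡.frameScalar f).re = scalarCurv 𝓡 := by
  rw [𝓡.frameScalar_eq_stdVec hf]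
  simp [frameScalar, scalarCurv]

end AKCT

/-- The phase vector attached to a choice of exponents modulo `4`. -/
def phase {n : ℕ} (e : Fin n → ZMod 4) (j : Fin n) : ℂ := ZMod.stdAddChar (e j)

lemma phase_mul_conj {n : ℕ} (e : Fin n → ZMod 4) (j : Fin n) :
    phase e j * starRingEnd ℂ (phase e j) = 1 := by
  rw [phase, ← AddChar.map_neg_eq_conj, ← AddChar.map_add_eq_mul]
  simp

lemma sum_phase {n : ℕ} (a b c d : Fin n) :
    ∑ e : Fin n → ZMod 4, phase e a * starRingEnd ℂ (phase e b) * phase e c *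
      starRingEnd ℂ (phase e d) =
      if (a = b ∧ c = d) ∨ (a = d ∧ c = b) then 4 ^ n else 0 := by
  split_ifs with h
  · have : ∀ e : Fin n → ZMod 4, phase e a * starRingEnd ℂ (phase e b) * phase e c *
        starRingEnd ℂ (phase e d) = 1 := by
      intro e
      rcases h with ⟨rfl, rfl⟩ | ⟨rfl, rfl⟩
      · rw [phase_mul_conj, one_mul, phase_mul_conj]
      · linear_combination (phase e c * starRingEnd ℂ (phase e c)) * phase_mul_conj e a +
          phase_mul_conj e c
    simp [this, ZMod.card]
  · have key : ∃ k : Fin n, (Pi.single k 1 : Fin n → ZMod 4) a -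
        (Pi.single k 1 : Fin n → ZMod 4) b + (Pi.single k 1 : Fin n → ZMod 4) c -
        (Pi.single k 1 : Fin n → ZMod 4) d ≠ 0 := by
      by_contra! hk
      have ha := hk a
      have hc := hk c
      simp only [Pi.single_apply] at ha hc
      split_ifs at ha hc <;>
        first
        | exact absurd ha (by decide)
        | exact absurd hc (by decide)
        | exact h (by grind)
    obtain ⟨k, hk⟩ := key
    set t : ZMod 4 := (Pi.single k 1 : Fin n → ZMod 4) a -
        (Pi.single k 1 : Fin n → ZMod 4) b + (Pi.single k 1 : Fin n → ZMod 4) c -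
        (Pi.single k 1 : Fin n → ZMod 4) d
    have hform : ∀ e : Fin n → ZMod 4, phase e a * starRingEnd ℂ (phase e b) * phase e c *
        starRingEnd ℂ (phase e d) = ZMod.stdAddChar (e a - e b + e c - e d) := by
      intro e
      simp only [phase, ← AddChar.map_neg_eq_conj, ← AddChar.map_add_eq_mul, sub_eq_add_neg]
    have ht : (ZMod.stdAddChar t : ℂ) ≠ 1 := by
      rw [← AddChar.map_zero_eq_one (ZMod.stdAddChar (N := 4))]
      exact fun h => hk (ZMod.injective_stdAddChar h)
    simp_rw [hform]
    have hshift := Equiv.sum_comp (Equiv.addRight (Pi.single k (1 : ZMod 4) : Fin n → ZMod 4))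
      fun e => (ZMod.stdAddChar (e a - e b + e c - e d) : ℂ)
    have hmul : ∀ e : Fin n → ZMod 4, (ZMod.stdAddChar
        (Equiv.addRight (Pi.single k (1 : ZMod 4) : Fin n → ZMod 4) e a -
         Equiv.addRight (Pi.single k (1 : ZMod 4) : Fin n → ZMod 4) e b +
         Equiv.addRight (Pi.single k (1 : ZMod 4) : Fin n → ZMod 4) e c -
         Equiv.addRight (Pi.single k (1 : ZMod 4) : Fin n → ZMod 4) e d) : ℂ) =
        ZMod.stdAddChar t * ZMod.stdAddChar (e a - e b + e c - e d) := by
      intro e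
      rw [← AddChar.map_add_eq_mul]
      congr 1
      simp only [Equiv.coe_addRight, Pi.add_apply, t]
      ring
    simp_rw [hmul, ← mul_sum] at hshift
    have : ((ZMod.stdAddChar t : ℂ) - 1) *
        ∑ e : Fin n → ZMod 4, (ZMod.stdAddChar (e a - e b + e c - e d) : ℂ) = 0 := by
      linear_combination hshift
    exact (mul_eq_zero.mp this).resolve_left (sub_ne_zero.mpr ht)

/-- The discrete Fourier transform supplies a unitary frame all of whose coordinates have the
same modulus. -/
lemma exists_flat_unitaryFrame (n : ℕ) (hn : n ≠ 0) : ∃ u : Fin n → Fin n → ℂ,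
    UnitaryFrame u ∧ ∀ k j, u k j * starRingEnd ℂ (u k j) = (n : ℂ)⁻¹ := by
  have hζ := Complex.isPrimitiveRoot_exp n hn
  set ζ := Complex.exp (2 * Real.pi * Complex.I / n)
  have hζc : ζ * starRingEnd ℂ ζ = 1 := by
    rw [Complex.mul_conj, Complex.normSq_eq_norm_sq, hζ.norm'_eq_one hn]
    simp
  have hs : ((√(n : ℝ) : ℝ) : ℂ)⁻¹ * ((√(n : ℝ) : ℝ) : ℂ)⁻¹ = (n : ℂ)⁻¹ := by
    rw [← mul_inv, ← Complex.ofReal_mul, Real.mul_self_sqrt (Nat.cast_nonneg n)]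
    simp
  have hflat : ∀ k j : Fin n, (((√(n : ℝ) : ℝ) : ℂ)⁻¹ * ζ ^ (k * j : ℕ)) *
      starRingEnd ℂ (((√(n : ℝ) : ℝ) : ℂ)⁻¹ * ζ ^ (k * j : ℕ)) = (n : ℂ)⁻¹ := by
    intro k j
    simp only [map_mul, map_inv₀, Complex.conj_ofReal, map_pow]
    rw [mul_mul_mul_comm, hs, ← mul_pow, hζc]
    simp
  refine ⟨fun k j => ((√(n : ℝ) : ℝ) : ℂ)⁻¹ * ζ ^ (k * j : ℕ), fun k l => ?_, hflat⟩
  split_ifs with hkl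
  · subst hkl
    simp_rw [hermInner, mul_comm (starRingEnd ℂ _), hflat]
    simp [hn]
  · set q : ℂ := starRingEnd ℂ ζ ^ (k : ℕ) * ζ ^ (l : ℕ) with hq
    have hqn : q ^ n = 1 := by
      rw [hq, mul_pow, ← pow_mul, ← pow_mul, mul_comm (k : ℕ), mul_comm (l : ℕ), pow_mul, pow_mul,
        ← map_pow, hζ.pow_eq_one]
      simp
    have hq1 : q ≠ 1 := by
      intro h
      apply hkl
      have : ζ ^ (k : ℕ) = ζ ^ (l : ℕ) := by
        have h2 : (ζ * starRingEnd ℂ ζ) ^ (k : ℕ) = 1 := by rw [hζc, one_pow]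
        rw [mul_pow] at h2
        linear_combination (-ζ ^ (k : ℕ)) * h + ζ ^ (l : ℕ) * h2
      exact Fin.ext (hζ.pow_inj k.2 l.2 this)
    have hgeom : ∑ j : Fin n, q ^ (j : ℕ) = 0 := by
      rw [Fin.sum_univ_eq_sum_range (fun j => q ^ j), geom_sum_eq hq1, hqn]
      simp
    have : ∀ j : Fin n, starRingEnd ℂ (((√(n : ℝ) : ℝ) : ℂ)⁻¹ * ζ ^ (k * j : ℕ)) *
        (((√(n : ℝ) : ℝ) : ℂ)⁻¹ * ζ ^ (l * j : ℕ)) = (n : ℂ)⁻¹ * q ^ (j : ℕ) := by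
      intro j
      simp only [map_mul, map_inv₀, Complex.conj_ofReal, map_pow]
      rw [mul_mul_mul_comm, hs, pow_mul, pow_mul, ← mul_pow]
    simp_rw [hermInner, this, ← mul_sum, hgeom, mul_zero]

lemma UnitaryFrame.mul_phase {n : ℕ} {u : Fin n → Fin n → ℂ} (hu : UnitaryFrame u)
    (e : Fin n → ZMod 4) : UnitaryFrame fun k j => u k j * phase e j := by
  intro k l
  rw [← hu k l]
  refine sum_congr rfl fun j _ => ?_
  rw [map_mul]
  linear_combination (starRingEnd ℂ (u k j) * u l j) * phase_mul_conj e j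

namespace AKCT

variable {n : ℕ} (𝓡 : AKCT n)

lemma sum_phase_hol {x : Fin n → ℂ} (hx : ∀ j, x j * starRingEnd ℂ (x j) = (n : ℂ)⁻¹)
    (f : Fin n → Fin n → ℂ) :
    ∑ e : Fin n → ZMod 4, 𝓡.R (∑ j, (x j * phase e j) • f j) (∑ j, (x j * phase e j) • f j)
      (∑ j, (x j * phase e j) • f j) (∑ j, (x j * phase e j) • f j) =
      4 ^ n * ((n : ℂ)⁻¹ ^ 2 * (2 * 𝓡.frameScalar f - 𝓡.frameHol f)) := by
  have hterm : ∀ a b c d, ∑ e : Fin n → ZMod 4, (x a * phase e a) *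
      starRingEnd ℂ (x b * phase e b) * (x c * phase e c) * starRingEnd ℂ (x d * phase e d) *
        𝓡.R (f a) (f b) (f c) (f d) = 4 ^ n * ((n : ℂ)⁻¹ ^ 2 *
      ((if a = b then if c = d then 𝓡.R (f a) (f b) (f c) (f d) else 0 else 0) +
        (if a = d then if c = b then 𝓡.R (f a) (f b) (f c) (f d) else 0 else 0) -
        (if a = b then if a = c then if a = d then 𝓡.R (f a) (f b) (f c) (f d)
          else 0 else 0 else 0))) := by
    intro a b c d
    have : ∀ e : Fin n → ZMod 4, (x a * phase e a) *
        starRingEnd ℂ (x b * phase e b) * (x c * phase e c) * starRingEnd ℂ (x d * phase e d) *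
        𝓡.R (f a) (f b) (f c) (f d) =
        (x a * starRingEnd ℂ (x b) * x c * starRingEnd ℂ (x d) * 𝓡.R (f a) (f b) (f c) (f d)) *
        (phase e a * starRingEnd ℂ (phase e b) * phase e c * starRingEnd ℂ (phase e d)) := by
      intro e
      simp only [map_mul]
      ring
    simp_rw [this, ← mul_sum, sum_phase]
    by_cases h1 : a = b ∧ c = d
    · obtain ⟨rfl, rfl⟩ := h1
      have e1 := hx a
      have e2 := hx c
      have : x a * starRingEnd ℂ (x a) * x c * starRingEnd ℂ (x c) = (n : ℂ)⁻¹ ^ 2 := by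
        rw [mul_assoc, e1, e2, sq]
      rw [this]
      by_cases hac : a = c
      · subst hac; simp; ring
      · simp [hac]; ring
    · by_cases h2 : a = d ∧ c = b
      · obtain ⟨rfl, rfl⟩ := h2
        have : x a * starRingEnd ℂ (x c) * x c * starRingEnd ℂ (x a) = (n : ℂ)⁻¹ ^ 2 := by
          linear_combination (x c * starRingEnd ℂ (x c)) * hx a + (n : ℂ)⁻¹ * hx c
        rw [this]
        have hac : a ≠ c := fun h => h1 ⟨h, h.symm⟩
        simp [hac]; ring
      · rw [if_neg (by tauto)]
        have : ¬ (a = b ∧ a = c ∧ a = d) := by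
          rintro ⟨rfl, rfl, rfl⟩
          exact h1 ⟨rfl, rfl⟩
        simp only [← ite_and, if_neg h1, if_neg h2, if_neg this]
        simp
  have hexp : ∀ e : Fin n → ZMod 4, _ := fun e =>
    𝓡.map_sum (fun j => x j * phase e j) (fun j => x j * phase e j) (fun j => x j * phase e j)
      (fun j => x j * phase e j) f
  simp_rw [hexp]
  rw [sum_comm]
  simp_rw [sum_comm (s := (univ : Finset (Fin n → ZMod 4))), hterm]
  simp_rw [← mul_sum, sum_sub_distrib, sum_add_distrib]
  congr 2
  simp only [sum_ite_eq, mem_univ, if_true, frameScalar, frameHol, sum_const_zero, sum_ite_irrel]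
  have hswap : ∀ a, ∑ b, ∑ c, (if c = b then 𝓡.R (f a) (f b) (f c) (f a) else 0) =
      ∑ c, 𝓡.R (f a) (f a) (f c) (f c) := by
    intro a
    refine sum_congr rfl fun b _ => ?_
    rw [sum_ite_eq' univ b, if_pos (mem_univ b), 𝓡.kahler_symm, 𝓡.pair_symm]
  simp_rw [hswap]
  ring

lemma sum_frameHol_comb {u : Fin n → Fin n → ℂ}
    (hu : ∀ k j, u k j * starRingEnd ℂ (u k j) = (n : ℂ)⁻¹) (hn : n ≠ 0)
    (f : Fin n → Fin n → ℂ) :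
    n * ∑ e : Fin n → ZMod 4, 𝓡.frameHol (fun k => ∑ j, (u k j * phase e j) • f j) =
      4 ^ n * (2 * 𝓡.frameScalar f - 𝓡.frameHol f) := by
  simp_rw [frameHol]
  rw [sum_comm]
  simp_rw [𝓡.sum_phase_hol (hu _) f]
  have : (n : ℂ) ≠ 0 := Nat.cast_ne_zero.mpr hn
  simp only [sum_const, card_univ, Fintype.card_fin, nsmul_eq_mul, frameHol]
  field_simp

end AKCT

lemma card_mul_sum_perm_diag {ι : Type*} [Fintype ι] [DecidableEq ι] (d : ι → ℝ) (i : ι) :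
    Fintype.card ι * ∑ σ : Equiv.Perm ι, d (σ i) =
      Fintype.card (Equiv.Perm ι) * ∑ k, d k := by
  have hconst : ∀ k, ∑ σ : Equiv.Perm ι, d (σ k) = ∑ σ : Equiv.Perm ι, d (σ i) := fun k => by
    rw [← Equiv.sum_comp (Equiv.mulRight (Equiv.swap i k))]
    simp
  calc (Fintype.card ι : ℝ) * ∑ σ : Equiv.Perm ι, d (σ i)
      = ∑ k, ∑ σ : Equiv.Perm ι, d (σ k) := by simp [hconst]
    _ = Fintype.card (Equiv.Perm ι) * ∑ k, d k := by
      rw [sum_comm]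
      simp [Equiv.sum_comp]

lemma sum_erase_add_diag {ι : Type*} [Fintype ι] [DecidableEq ι] (m : ι → ι → ℝ) :
    (∑ i, ∑ j ∈ univ.erase i, m i j) + ∑ i, m i i = ∑ i, ∑ j, m i j := by
  rw [← sum_add_distrib]
  exact sum_congr rfl fun i _ => sum_erase_add _ _ (mem_univ i)

lemma exists_perm_map_pair {ι : Type*} [DecidableEq ι] {i j k l : ι} (hij : i ≠ j)
    (hkl : k ≠ l) : ∃ τ : Equiv.Perm ι, τ i = k ∧ τ j = l := by
  have hne : Equiv.swap i k j ≠ k := by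
    conv_rhs => rw [← Equiv.swap_apply_left i k]
    exact fun h => hij (((Equiv.swap i k).injective h).symm)
  refine ⟨Equiv.swap (Equiv.swap i k j) l * Equiv.swap i k, ?_, ?_⟩
  · simp [Equiv.swap_apply_of_ne_of_ne hne.symm hkl]
  · simp

lemma card_mul_sum_perm_offDiag {ι : Type*} [Fintype ι] [DecidableEq ι] (m : ι → ι → ℝ)
    {i j : ι} (hij : i ≠ j) :
    (Fintype.card ι * (Fintype.card ι - 1) : ℝ) * ∑ σ : Equiv.Perm ι, m (σ i) (σ j) =
      Fintype.card (Equiv.Perm ι) * ((∑ k, ∑ l, m k l) - ∑ k, m k k) := by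
  have hconst : ∀ k, ∀ l ∈ univ.erase k, ∑ σ : Equiv.Perm ι, m (σ k) (σ l) =
      ∑ σ : Equiv.Perm ι, m (σ i) (σ j) := by
    intro k l hl
    obtain ⟨τ, rfl, rfl⟩ := exists_perm_map_pair hij (ne_of_mem_erase hl).symm
    exact Equiv.sum_comp (Equiv.mulRight τ) (fun σ : Equiv.Perm ι => m (σ i) (σ j))
  have hcard : 1 ≤ Fintype.card ι := Fintype.card_pos_iff.mpr ⟨i⟩
  calc (Fintype.card ι * (Fintype.card ι - 1) : ℝ) * ∑ σ : Equiv.Perm ι, m (σ i) (σ j)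
      = ∑ k, ∑ l ∈ univ.erase k, ∑ σ : Equiv.Perm ι, m (σ k) (σ l) := by
        simp_rw [fun k => sum_congr rfl (hconst k)]
        simp [card_erase_of_mem, Nat.cast_sub hcard, mul_assoc]
    _ = (∑ σ : Equiv.Perm ι, ∑ k, ∑ l, m (σ k) (σ l)) -
          ∑ σ : Equiv.Perm ι, ∑ k, m (σ k) (σ k) := by
        rw [eq_sub_iff_add_eq, sum_comm (t := univ) (f := fun (σ : Equiv.Perm ι) k => m (σ k) (σ k)),
          sum_erase_add_diag fun k l => ∑ σ : Equiv.Perm ι, m (σ k) (σ l), sum_comm]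
        refine Eq.trans ?_ sum_comm
        rw [sum_comm]
        exact sum_congr rfl fun k _ => sum_comm
    _ = _ := by
        have h : ∀ σ : Equiv.Perm ι, ∑ k, ∑ l, m (σ k) (σ l) = ∑ k, ∑ l, m k l := fun σ => by
          rw [← Equiv.sum_comp σ (fun k => ∑ l, m k l)]
          exact sum_congr rfl fun k _ => Equiv.sum_comp σ (m (σ k))
        have h' : ∀ σ : Equiv.Perm ι, ∑ k, m (σ k) (σ k) = ∑ k, m k k := fun σ =>
          Equiv.sum_comp σ fun k => m k k
        simp [h, h', mul_sub]

/-- Averaging a pairing of two matrices over the simultaneous row and column permutations of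
one of them. -/
lemma card_mul_sum_perm_pairing {ι : Type*} [Fintype ι] [DecidableEq ι] (m a : ι → ι → ℝ) :
    (Fintype.card ι * (Fintype.card ι - 1) : ℝ) *
        ∑ σ : Equiv.Perm ι, ∑ i, ∑ j, m (σ i) (σ j) * a i j =
      Fintype.card (Equiv.Perm ι) * ((Fintype.card ι - 1) * (∑ i, a i i) * (∑ i, m i i) +
        (∑ i, ∑ j ∈ univ.erase i, a i j) * ((∑ i, ∑ j, m i j) - ∑ i, m i i)) := by
  have hsplit : ∑ σ : Equiv.Perm ι, ∑ i, ∑ j, m (σ i) (σ j) * a i j =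
      (∑ i, ∑ j ∈ univ.erase i, (∑ σ : Equiv.Perm ι, m (σ i) (σ j)) * a i j) +
        ∑ i, (∑ σ : Equiv.Perm ι, m (σ i) (σ i)) * a i i := by
    rw [sum_erase_add_diag fun i j => (∑ σ : Equiv.Perm ι, m (σ i) (σ j)) * a i j, sum_comm]
    refine sum_congr rfl fun i _ => ?_
    rw [sum_comm]
    simp_rw [sum_mul]
  have hoff : ∀ i, ∀ j ∈ univ.erase i, (Fintype.card ι * (Fintype.card ι - 1) : ℝ) *
      ((∑ σ : Equiv.Perm ι, m (σ i) (σ j)) * a i j) =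
      Fintype.card (Equiv.Perm ι) * ((∑ k, ∑ l, m k l) - ∑ k, m k k) * a i j := by
    intro i j hj
    rw [← mul_assoc, card_mul_sum_perm_offDiag m (ne_of_mem_erase hj).symm]
  have hdiag : ∀ i, (Fintype.card ι * (Fintype.card ι - 1) : ℝ) *
      ((∑ σ : Equiv.Perm ι, m (σ i) (σ i)) * a i i) =
      (Fintype.card ι - 1) * Fintype.card (Equiv.Perm ι) * (∑ k, m k k) * a i i := by
    intro i
    linear_combination ((Fintype.card ι - 1) * a i i) * card_mul_sum_perm_diag (fun k => m k k) i
  rw [hsplit, mul_add, mul_sum, mul_sum]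
  simp_rw [mul_sum _ _ (Fintype.card ι * (Fintype.card ι - 1) : ℝ),
    fun i => sum_congr rfl (hoff i), hdiag, ← mul_sum]
  ring

/-- Lemma 3.2(a), algebraic form: if there is a real matrix `a`
with `∑_{i≠j} a_{ij} + 2 ∑_i a_{ii} > 0` such that the frame-wise inequality
`∑_{i,j} R(f_i,f̄_i,f_j,f̄_j) a_{ij} ≥ 0` holds for every unitary frame, then the
scalar curvature is nonnegative; if the inequality is strict for some frame, the
scalar curvature is positive. -/
theorem stmt10 (n : ℕ) (hn : 2 ≤ n) (𝓡 : AKCT n)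
    (a : Matrix (Fin n) (Fin n) ℝ)
    (htr : 0 < (∑ i, ∑ j ∈ Finset.univ.erase i, a i j) + 2 * ∑ i, a i i)
    (hineq : ∀ f : Fin n → Fin n → ℂ, UnitaryFrame f →
      0 ≤ ∑ i, ∑ j, (𝓡.R (f i) (f i) (f j) (f j)).re * a i j) :
    0 ≤ scalarCurv 𝓡 ∧
      ((∃ f : Fin n → Fin n → ℂ, UnitaryFrame f ∧
          0 < ∑ i, ∑ j, (𝓡.R (f i) (f i) (f j) (f j)).re * a i j) →
        0 < scalarCurv 𝓡) := by
  have hn0 : n ≠ 0 := by lia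
  have hn1 : (0 : ℝ) < n - 1 := by
    have : (2 : ℝ) ≤ n := by exact_mod_cast hn
    linarith
  have hnpos : (0 : ℝ) < n := by linarith
  set A := ∑ i, a i i
  set B := ∑ i, ∑ j ∈ univ.erase i, a i j
  set S := scalarCurv 𝓡
  set q : (Fin n → Fin n → ℂ) → ℝ := fun f => ∑ i, ∑ j, (𝓡.R (f i) (f i) (f j) (f j)).re * a i j
  set g : (Fin n → Fin n → ℂ) → ℝ := fun f =>
    (n - 1) * A * (𝓡.frameHol f).re + B * (S - (𝓡.frameHol f).re)
  have hperm : ∀ f, UnitaryFrame f →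
      (n * (n - 1) : ℝ) * ∑ σ : Equiv.Perm (Fin n), q (fun i => f (σ i)) =
        n.factorial * g f := by
    intro f hf
    have := card_mul_sum_perm_pairing (fun i j => (𝓡.R (f i) (f i) (f j) (f j)).re) a
    simp only [Fintype.card_perm, Fintype.card_fin] at this
    simp only [g, q, S, ← 𝓡.frameScalar_re hf, AKCT.frameScalar, AKCT.frameHol, Complex.re_sum]
    exact this
  have hfact : (0 : ℝ) < n.factorial := by exact_mod_cast n.factorial_pos
  have hq : ∀ f, UnitaryFrame f → ∀ σ : Equiv.Perm (Fin n), 0 ≤ q (fun i => f (σ i)) :=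
    fun f hf σ => hineq _ (hf.comp_perm σ)
  have hg : ∀ f, UnitaryFrame f → 0 ≤ g f := by
    intro f hf
    refine nonneg_of_mul_nonneg_right ?_ hfact
    rw [← hperm f hf]
    exact mul_nonneg (by positivity) (sum_nonneg fun σ _ => hq f hf σ)
  have hmain : ∀ f, UnitaryFrame f → g f ≤ (n - 1) * (B + 2 * A) * S := by
    intro f hf
    obtain ⟨u, hu, hflat⟩ := exists_flat_unitaryFrame n hn0
    have hsum : 0 ≤ ∑ e : Fin n → ZMod 4, g (fun k => ∑ j, (u k j * phase e j) • f j) :=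
      sum_nonneg fun e _ => hg _ ((hu.mul_phase e).comb hf)
    have havg := congrArg Complex.re (𝓡.sum_frameHol_comb hflat hn0 f)
    have h4 : (4 : ℂ) ^ n = ((4 ^ n : ℝ) : ℂ) := by push_cast; rfl
    rw [h4, ← Complex.ofReal_natCast, Complex.re_ofReal_mul, Complex.re_ofReal_mul,
      Complex.re_sum, Complex.sub_re, ← Complex.ofReal_ofNat, Complex.re_ofReal_mul,
      𝓡.frameScalar_re hf] at havg
    have hsplit : ∑ e : Fin n → ZMod 4, g (fun k => ∑ j, (u k j * phase e j) • f j) =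
        4 ^ n * (B * S) + ((n - 1) * A - B) * ∑ e : Fin n → ZMod 4,
          (𝓡.frameHol (fun k => ∑ j, (u k j * phase e j) • f j)).re := by
      have : ∀ f, g f = B * S + ((n - 1) * A - B) * (𝓡.frameHol f).re := fun f => by
        simp only [g]
        ring
      simp_rw [this, sum_add_distrib, ← mul_sum]
      simp [ZMod.card, mul_left_comm]
    have hfin : n * ∑ e : Fin n → ZMod 4, g (fun k => ∑ j, (u k j * phase e j) • f j) =
        4 ^ n * ((n - 1) * (B + 2 * A) * S - g f) := by
      rw [hsplit]
      simp only [g]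
      linear_combination ((n - 1) * A - B) * havg
    have : 0 ≤ (4 : ℝ) ^ n * ((n - 1) * (B + 2 * A) * S - g f) := by
      rw [← hfin]
      positivity
    exact sub_nonneg.mp (nonneg_of_mul_nonneg_right this (by positivity))
  have hc : 0 < (n - 1) * (B + 2 * A) := mul_pos hn1 htr
  refine ⟨nonneg_of_mul_nonneg_right ((hg _ unitaryFrame_stdVec).trans
    (hmain _ unitaryFrame_stdVec)) hc, ?_⟩
  rintro ⟨f, hf, hpos⟩
  have hgpos : 0 < g f := by
    refine pos_of_mul_pos_right ?_ hfact.le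
    rw [← hperm f hf]
    exact mul_pos (by positivity) (sum_pos' (fun σ _ => hq f hf σ) ⟨1, mem_univ _, hpos⟩)
  exact pos_of_mul_pos_right (hgpos.trans_le (hmain f hf)) hc.le

end
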